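/- For every natural number n ≥ 1, there exist a bijection φ from the set F_n of rooted labeled forests on n vertices onto the set PF_n of parking functions of length n and, for each forest F ∈ F_n, a bijection θ_F : {1,...,n} → {1,...,n} from the vertices of F to the cars of φ(F), such that: (1) for every vertex v of F, inv(F:v) = jump(φ(F) : θ_F(v)); and (2) if v is a root of one of the trees of F, then the car θ_F(v) is a right-to-left maximum in PA(φ(F))^{−1}, i.e., every car parked (under the parking algorithm applied to φ(F)) in a space strictly to the right of the space of car θ_F(v) has a smaller car number than θ_F(v). -/

import Mathlib

/-!  Parking functions and the parking algorithm. -/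

/-- Parking algorithm: cars `0, 1, ..., n-1` (in Lean's 0-based indexing of `Fin n`,
representing cars `1, ..., n`) arrive in order; car `i` drives to its favorite
(1-indexed) space `p i` and parks in the first space `s ≥ p i` not occupied by an
earlier car.  `PA p i` is the space where car `i` actually parks. -/
noncomputable def PA {n : ℕ} (p : Fin n → ℕ) (i : Fin n) : ℕ :=
  sInf {s : ℕ | p i ≤ s ∧ ∀ j : Fin n, j < i → PA p j ≠ s}
termination_by i.val
decreasing_by exact ‹_ < _›

/-- `p` is a parking function of length `n`: every favorite space is in `{1, ..., n}`
and every car ends up parked in a space `≤ n`. -/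
def IsParkingFunction {n : ℕ} (p : Fin n → ℕ) : Prop :=
  (∀ i, 1 ≤ p i ∧ p i ≤ n) ∧ ∀ i, PA p i ≤ n

/-- The set (type) `PF_n` of parking functions of length `n`. -/
def ParkingFunction (n : ℕ) : Type :=
  {p : Fin n → ℕ // IsParkingFunction p}

instance {n : ℕ} : Finite (ParkingFunction n) := by
  apply Finite.of_injective
    (fun P : ParkingFunction n => fun i => (⟨P.1 i, Nat.lt_succ_of_le (P.2.1 i).2⟩ : Fin (n+1)))
  intro P Q h
  apply Subtype.ext; funext i
  simpa [Fin.mk.injEq] using congrFun h i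

noncomputable instance {n : ℕ} : Fintype (ParkingFunction n) := Fintype.ofFinite _

/-- `jumpAt p c` is the number of jumps of car `c`, i.e. `q_c - p_c`. -/
noncomputable def jumpAt {n : ℕ} (p : Fin n → ℕ) (c : Fin n) : ℕ := PA p c - p c

/-- `jump p` is the total number of jumps. -/
noncomputable def jump {n : ℕ} (p : Fin n → ℕ) : ℕ := ∑ c, jumpAt p c

/-- `luckyCount p k` is the number of cars `c` with `jump(p : c) = k`. -/
noncomputable def luckyCount {n : ℕ} (p : Fin n → ℕ) (k : ℕ) : ℕ :=
  Set.ncard {c : Fin n | jumpAt p c = k}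

/-- `lucky p` is the number of lucky cars, i.e. cars with no jumps. -/
noncomputable def lucky {n : ℕ} (p : Fin n → ℕ) : ℕ :=
  Set.ncard {c : Fin n | jumpAt p c = 0}

/-- Car `c` is critical: immediately after car `c` is parked, there is no empty space
among the spaces strictly to the right of its space `q_c` within `{1, ..., n}`. -/
def IsCritical {n : ℕ} (p : Fin n → ℕ) (c : Fin n) : Prop :=
  ∀ s : ℕ, PA p c < s → s ≤ n → ∃ j : Fin n, j ≤ c ∧ PA p j = s

/-- `critic p` is the number of critical cars. -/
noncomputable def critic {n : ℕ} (p : Fin n → ℕ) : ℕ :=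
  Set.ncard {c : Fin n | IsCritical p c}

/-!  Rooted labeled forests, encoded by their parent function. -/

/-- A parent function `par : Fin n → Option (Fin n)` (where `par v = none` means that
`v` is a root) encodes a rooted labeled forest on `n` vertices iff it has no cycles. -/
def IsForest {n : ℕ} (par : Fin n → Option (Fin n)) : Prop :=
  ∀ v : Fin n, ¬ Relation.TransGen (fun a b => par a = some b) v v

/-- The set (type) `F_n` of rooted labeled forests on `n` vertices. -/
def Forest (n : ℕ) : Type := {par : Fin n → Option (Fin n) // IsForest par}

instance {n : ℕ} : Finite (Forest n) := Subtype.finite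
noncomputable instance {n : ℕ} : Fintype (Forest n) := Fintype.ofFinite _

/-- `x` is a descendant of `v`: `v` lies on the (unique) path from the root of `x`'s
component to `x`, i.e. the ancestor chain of `x` reaches `v`. -/
def Descendant {n : ℕ} (par : Fin n → Option (Fin n)) (v x : Fin n) : Prop :=
  Relation.ReflTransGen (fun a b => par a = some b) x v

/-- `forestInvAt F v = inv(F : v)`, the number of pairs `(v, x)` with `v > x` and
`x` a descendant of `v`. -/
noncomputable def forestInvAt {n : ℕ} (F : Forest n) (v : Fin n) : ℕ :=
  Set.ncard {x : Fin n | x < v ∧ Descendant F.1 v x}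

/-- `forestInv F = inv(F)`, the total number of inversions of `F`. -/
noncomputable def forestInv {n : ℕ} (F : Forest n) : ℕ := ∑ v, forestInvAt F v

/-- `forestLeadCount F k` is the number of vertices `v` with `inv(F : v) = k`. -/
noncomputable def forestLeadCount {n : ℕ} (F : Forest n) (k : ℕ) : ℕ :=
  Set.ncard {v : Fin n | forestInvAt F v = k}

/-- `forestLead F = lead(F)`, the number of leaders of `F`. -/
noncomputable def forestLead {n : ℕ} (F : Forest n) : ℕ :=
  Set.ncard {v : Fin n | forestInvAt F v = 0}

/-- `forestTree F = tree(F)`, the number of trees (connected components) of `F`,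
i.e. the number of roots. -/
noncomputable def forestTree {n : ℕ} (F : Forest n) : ℕ :=
  Set.ncard {v : Fin n | F.1 v = none}

open Finset Relation

section Forests

variable {α : Type*}

/-- `Reach f x v`: iterating the parent function `f` from `x` leads to `v`. -/
def Reach (f : α → Option α) (x v : α) : Prop :=
  ReflTransGen (fun a b => f a = some b) x v

/-- `f` is the parent function of a rooted forest on the vertex set `S`. -/
structure IsForestOn (S : Finset α) (f : α → Option α) : Prop where
  eq_none : ∀ v, v ∉ S → f v = none
  mem_of_eq_some : ∀ v w, f v = some w → w ∈ S
  exists_root : ∀ v, ∃ r, f r = none ∧ Reach f v r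

lemma Reach.head {f : α → Option α} {x y v : α} (h : f x = some y) (hy : Reach f y v) :
    Reach f x v :=
  ReflTransGen.head h hy

lemma Reach.eq_or_head {f : α → Option α} {x v : α} (h : Reach f x v) :
    x = v ∨ ∃ y, f x = some y ∧ Reach f y v :=
  ReflTransGen.cases_head h

lemma Reach.root_unique {f : α → Option α} {x r r' : α} (hr : f r = none) (hr' : f r' = none)
    (h : Reach f x r) (h' : Reach f x r') : r = r' := by
  induction h using ReflTransGen.head_induction_on with
  | refl =>
    rcases h'.eq_or_head with h | ⟨y, hy, -⟩
    · exact h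
    · simp [hr] at hy
  | head hxy _ ih =>
    rcases h'.eq_or_head with h | ⟨y, hy, hy'⟩
    · subst h; simp [hr'] at hxy
    · rw [hxy] at hy
      cases hy
      exact ih hy'

lemma exists_root_of_le {f g : α → Option α} (hgf : ∀ v w, g v = some w → f v = some w)
    (hf : ∀ v, ∃ r, f r = none ∧ Reach f v r) (v : α) : ∃ r, g r = none ∧ Reach g v r := by
  obtain ⟨r, hr, h⟩ := hf v
  induction h using ReflTransGen.head_induction_on with
  | refl =>
    refine ⟨r, ?_, ReflTransGen.refl⟩
    cases hg : g r with
    | none => rfl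
    | some w => simp [hgf _ _ hg] at hr
  | @head x y hxy _ ih =>
    cases hg : g x with
    | none => exact ⟨x, hg, ReflTransGen.refl⟩
    | some w =>
      have hw := hgf _ _ hg
      rw [hxy] at hw
      cases hw
      obtain ⟨ρ, hρ, h⟩ := ih
      exact ⟨ρ, hρ, h.head hg⟩

lemma not_transGen_self_of_exists_root {f : α → Option α}
    (hf : ∀ v, ∃ r, f r = none ∧ Reach f v r) (v : α) :
    ¬ TransGen (fun a b => f a = some b) v v := by
  obtain ⟨r, hr, h⟩ := hf v
  induction h using ReflTransGen.head_induction_on with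
  | refl =>
    intro hc
    obtain ⟨y, hy, -⟩ := TransGen.head'_iff.1 hc
    simp [hr] at hy
  | head hxy _ ih =>
    intro hc
    obtain ⟨z, hz, hzx⟩ := TransGen.head'_iff.1 hc
    rw [hxy] at hz
    cases hz
    exact ih (TransGen.tail' hzx hxy)

lemma exists_root_of_acyclic [Finite α] {f : α → Option α}
    (hf : ∀ v, ¬ TransGen (fun a b => f a = some b) v v) (v : α) :
    ∃ r, f r = none ∧ Reach f v r := by
  have : Std.Irrefl (TransGen fun a b : α => f b = some a) :=
    ⟨fun a h => hf a (transGen_swap.1 h)⟩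
  have hwf : WellFounded (TransGen fun a b : α => f b = some a) :=
    Finite.wellFounded_of_trans_of_irrefl _
  induction v using hwf.induction with
  | _ v ih =>
    cases h : f v with
    | none => exact ⟨v, h, ReflTransGen.refl⟩
    | some w =>
      obtain ⟨r, hr, hw⟩ := ih w (TransGen.single h)
      exact ⟨r, hr, hw.head h⟩

lemma isForestOn_empty_iff {f : α → Option α} : IsForestOn ∅ f ↔ f = fun _ => none := by
  constructor
  · exact fun h => funext fun v => h.eq_none v (notMem_empty v)
  · rintro rfl
    exact ⟨fun _ _ => rfl, fun _ _ h => by simp at h, fun v => ⟨v, rfl, ReflTransGen.refl⟩⟩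

variable [DecidableEq α]

/-- The forest made of a tree on `X` with root `r`, whose branches form the forest `f₁`,
and of the forest `f₂` outside `X`. -/
def graft (X : Finset α) (r : α) (f₁ f₂ : α → Option α) (v : α) : Option α :=
  if v = r then none else if v ∈ X then some ((f₁ v).getD r) else f₂ v

section Graft

variable {S X : Finset α} {r : α} {f₁ f₂ : α → Option α}

lemma graft_root : graft X r f₁ f₂ r = none := by simp [graft]

lemma graft_of_mem {v : α} (hv : v ∈ X) (hvr : v ≠ r) :
    graft X r f₁ f₂ v = some ((f₁ v).getD r) := by simp [graft, hv, hvr]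

lemma graft_of_notMem {v : α} (hr : r ∈ X) (hv : v ∉ X) : graft X r f₁ f₂ v = f₂ v := by
  have : v ≠ r := fun h => hv (h ▸ hr)
  simp [graft, hv, this]

lemma graft_eq_some_mem_iff (h₁ : IsForestOn (X.erase r) f₁) (h₂ : IsForestOn (S \ X) f₂)
    (hr : r ∈ X) {v w : α} (h : graft X r f₁ f₂ v = some w) : v ∈ X ↔ w ∈ X := by
  by_cases hvr : v = r
  · subst hvr; simp [graft_root] at h
  by_cases hv : v ∈ X
  · rw [graft_of_mem hv hvr] at h
    cases hf : f₁ v with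
    | none => simp_all
    | some u =>
      have := h₁.mem_of_eq_some _ _ hf
      simp_all
  · rw [graft_of_notMem hr hv] at h
    have := h₂.mem_of_eq_some _ _ h
    simp_all

lemma reach_graft_of_mem (h₁ : IsForestOn (X.erase r) f₁) (h₂ : IsForestOn (S \ X) f₂)
    (hr : r ∈ X) {v x : α} (hv : v ∈ X) (hvr : v ≠ r) :
    Reach (graft X r f₁ f₂) x v ↔ Reach f₁ x v := by
  constructor
  · intro h
    induction h using ReflTransGen.head_induction_on with
    | refl => exact ReflTransGen.refl
    | @head x y hxy _ ih =>
      have hy : y ∈ X ∧ y ≠ r := by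
        rcases ih.eq_or_head with rfl | ⟨z, hz, -⟩
        · exact ⟨hv, hvr⟩
        · by_contra hc
          have := h₁.eq_none y (by simp; tauto)
          simp [this] at hz
      have hx := (graft_eq_some_mem_iff h₁ h₂ hr hxy).2 hy.1
      have hxr : x ≠ r := by
        rintro rfl; simp [graft_root] at hxy
      rw [graft_of_mem hx hxr] at hxy
      refine ih.head ?_
      cases hf : f₁ x with
      | none => simp_all
      | some u => simp_all
  · intro h
    induction h using ReflTransGen.head_induction_on with
    | refl => exact ReflTransGen.refl
    | @head x y hxy _ ih =>
      have hx : x ∈ X.erase r := by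
        by_contra hc
        simp [h₁.eq_none x hc] at hxy
      rw [mem_erase] at hx
      refine ih.head ?_
      rw [graft_of_mem hx.2 hx.1, hxy]
      rfl

lemma reach_graft_of_notMem (h₁ : IsForestOn (X.erase r) f₁) (h₂ : IsForestOn (S \ X) f₂)
    (hr : r ∈ X) {v x : α} (hv : v ∉ X) :
    Reach (graft X r f₁ f₂) x v ↔ Reach f₂ x v := by
  constructor
  · intro h
    induction h using ReflTransGen.head_induction_on with
    | refl => exact ReflTransGen.refl
    | @head x y hxy _ ih =>
      have hy : y ∉ X := by
        rcases ih.eq_or_head with rfl | ⟨z, hz, -⟩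
        · exact hv
        · intro hc
          have := h₂.eq_none y (by simp [hc])
          simp [this] at hz
      have hx : x ∉ X := fun hx => hy ((graft_eq_some_mem_iff h₁ h₂ hr hxy).1 hx)
      rw [graft_of_notMem hr hx] at hxy
      exact ih.head hxy
  · intro h
    induction h using ReflTransGen.head_induction_on with
    | refl => exact ReflTransGen.refl
    | @head x y hxy _ ih =>
      have hx : x ∉ X := by
        intro hc
        simp [h₂.eq_none x (by simp [hc])] at hxy
      refine ih.head ?_
      rw [graft_of_notMem hr hx, hxy]

lemma reach_graft_root (h₁ : IsForestOn (X.erase r) f₁) (h₂ : IsForestOn (S \ X) f₂)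
    (hr : r ∈ X) {x : α} : Reach (graft X r f₁ f₂) x r ↔ x ∈ X := by
  constructor
  · intro h
    induction h using ReflTransGen.head_induction_on with
    | refl => exact hr
    | head hxy _ ih => exact (graft_eq_some_mem_iff h₁ h₂ hr hxy).2 ih
  · intro hx
    by_cases hxr : x = r
    · subst hxr; exact ReflTransGen.refl
    obtain ⟨ρ, hρ, h⟩ := h₁.exists_root x
    have hρX : ρ ∈ X.erase r := by
      rcases ReflTransGen.cases_tail h with rfl | ⟨y, -, hy⟩
      · exact mem_erase.2 ⟨hxr, hx⟩
      · exact h₁.mem_of_eq_some _ _ hy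
    rw [mem_erase] at hρX
    refine ReflTransGen.tail ((reach_graft_of_mem h₁ h₂ hr hρX.2 hρX.1).2 h) ?_
    rw [graft_of_mem hρX.2 hρX.1, hρ]
    rfl

lemma IsForestOn.graft (h₁ : IsForestOn (X.erase r) f₁) (h₂ : IsForestOn (S \ X) f₂)
    (hr : r ∈ X) (hX : X ⊆ S) : IsForestOn S (graft X r f₁ f₂) where
  eq_none v hv := by
    have hvX : v ∉ X := fun h => hv (hX h)
    rw [graft_of_notMem hr hvX]
    exact h₂.eq_none v (by simp [hv])
  mem_of_eq_some v w h := by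
    by_cases hw : w ∈ X
    · exact hX hw
    · have hv : v ∉ X := fun hv => hw ((graft_eq_some_mem_iff h₁ h₂ hr h).1 hv)
      rw [graft_of_notMem hr hv] at h
      exact (mem_sdiff.1 (h₂.mem_of_eq_some _ _ h)).1
  exists_root v := by
    by_cases hv : v ∈ X
    · exact ⟨r, graft_root, (reach_graft_root h₁ h₂ hr).2 hv⟩
    · obtain ⟨ρ, hρ, h⟩ := h₂.exists_root v
      have hρX : ρ ∉ X := by
        rcases ReflTransGen.cases_tail h with rfl | ⟨y, -, hy⟩
        · exact hv
        · exact (mem_sdiff.1 (h₂.mem_of_eq_some _ _ hy)).2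
      exact ⟨ρ, by rw [graft_of_notMem hr hρX, hρ], (reach_graft_of_notMem h₁ h₂ hr hρX).2 h⟩

lemma graft_injective {X' : Finset α} {r' m : α} {f₁' f₂' : α → Option α}
    (h₁ : IsForestOn (X.erase r) f₁) (h₂ : IsForestOn (S \ X) f₂)
    (h₁' : IsForestOn (X'.erase r') f₁') (h₂' : IsForestOn (S \ X') f₂')
    (hr : r ∈ X) (hr' : r' ∈ X') (hm : m ∈ X) (hm' : m ∈ X')
    (h : graft X r f₁ f₂ = graft X' r' f₁' f₂') :
    X = X' ∧ r = r' ∧ f₁ = f₁' ∧ f₂ = f₂' := by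
  have hrr : r = r' := by
    refine Reach.root_unique (f := graft X r f₁ f₂) (x := m) graft_root (h ▸ graft_root)
      ((reach_graft_root h₁ h₂ hr).2 hm) ?_
    rw [h]
    exact (reach_graft_root h₁' h₂' hr').2 hm'
  subst hrr
  have hXX : X = X' := by
    ext x
    rw [← reach_graft_root h₁ h₂ hr, ← reach_graft_root h₁' h₂' hr', h]
  subst hXX
  refine ⟨rfl, rfl, ?_, ?_⟩
  · funext v
    by_cases hv : v ∈ X.erase r
    · have hvX := mem_erase.1 hv
      have e := congrFun h v
      rw [graft_of_mem hvX.2 hvX.1, graft_of_mem hvX.2 hvX.1] at e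
      cases hf : f₁ v with
      | none =>
        cases hf' : f₁' v with
        | none => rfl
        | some u =>
          have := h₁'.mem_of_eq_some _ _ hf'
          simp_all
      | some w =>
        have := h₁.mem_of_eq_some _ _ hf
        cases hf' : f₁' v with
        | none => simp_all
        | some u => simp_all
    · rw [h₁.eq_none v hv, h₁'.eq_none v hv]
  · funext v
    by_cases hv : v ∈ X
    · rw [h₂.eq_none v (by simp [hv]), h₂'.eq_none v (by simp [hv])]
    · have e := congrFun h v
      rwa [graft_of_notMem hr hv, graft_of_notMem hr hv] at e

lemma exists_graft_eq {f : α → Option α} {m : α} (hf : IsForestOn S f) (hm : m ∈ S) :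
    ∃ X r f₁ f₂, m ∈ X ∧ X ⊆ S ∧ r ∈ X ∧ IsForestOn (X.erase r) f₁ ∧ IsForestOn (S \ X) f₂ ∧
      graft X r f₁ f₂ = f := by
  classical
  obtain ⟨r, hr, hmr⟩ := hf.exists_root m
  have hrS : r ∈ S := by
    rcases ReflTransGen.cases_tail hmr with rfl | ⟨y, -, hy⟩
    · exact hm
    · exact hf.mem_of_eq_some _ _ hy
  have hS : ∀ {v w}, f v = some w → v ∈ S := fun {v w} h => by
    by_contra hc
    simp [hf.eq_none v hc] at h
  set X := S.filter (fun v => Reach f v r) with hX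
  have hrX : r ∈ X := by simp only [hX, mem_filter]; exact ⟨hrS, ReflTransGen.refl⟩
  set f₁ : α → Option α :=
    fun v => if v ∈ X.erase r then (if f v = some r then none else f v) else none with hf₁
  set f₂ : α → Option α := fun v => if v ∈ X then none else f v with hf₂
  have key₁ : ∀ v w, f₁ v = some w → v ∈ X.erase r ∧ w ≠ r ∧ f v = some w := by
    intro v w h
    simp only [hf₁] at h
    split_ifs at h with h₁ h₂
    exact ⟨h₁, fun e => h₂ (e ▸ h), h⟩
  have key₂ : ∀ v w, f₂ v = some w → v ∉ X ∧ f v = some w := by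
    intro v w h
    simp only [hf₂] at h
    split_ifs at h with h₁
    exact ⟨h₁, h⟩
  refine ⟨X, r, f₁, f₂, by simp [hX, hm, hmr], filter_subset _ _, hrX,
    ⟨fun v hv => if_neg hv, fun v w h => ?_, exists_root_of_le (fun v w h => (key₁ v w h).2.2)
      hf.exists_root⟩,
    ⟨fun v hv => ?_, fun v w h => ?_, exists_root_of_le (fun v w h => (key₂ v w h).2)
      hf.exists_root⟩, ?_⟩
  · obtain ⟨hv, hw, hvw⟩ := key₁ v w h
    rw [mem_erase, hX, mem_filter] at hv
    rw [mem_erase, hX, mem_filter]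
    rcases hv.2.2.eq_or_head with e | ⟨y, hy, hyr⟩
    · exact absurd e hv.1
    · rw [hvw] at hy
      cases hy
      exact ⟨hw, hf.mem_of_eq_some _ _ hvw, hyr⟩
  · by_cases hvX : v ∈ X
    · exact if_pos hvX
    · simp only [hf₂, if_neg hvX]
      exact hf.eq_none v fun hvS => hv (mem_sdiff.2 ⟨hvS, hvX⟩)
  · obtain ⟨hv, hvw⟩ := key₂ v w h
    refine mem_sdiff.2 ⟨hf.mem_of_eq_some _ _ hvw, fun hw => hv ?_⟩
    rw [hX, mem_filter] at hw ⊢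
    exact ⟨hS hvw, hw.2.head hvw⟩
  · funext v
    by_cases hvr : v = r
    · subst hvr
      rw [graft_root, hr]
    by_cases hv : v ∈ X
    · rw [graft_of_mem hv hvr]
      have hv' : v ∈ X.erase r := mem_erase.2 ⟨hvr, hv⟩
      obtain ⟨y, hy, -⟩ := (mem_filter.1 hv).2.eq_or_head.resolve_left hvr
      by_cases hyr : y = r <;> simp [hf₁, hy, hyr, hvr, hv]
    · rw [graft_of_notMem hrX hv]
      exact if_neg hv

end Graft

end Forests

section Parking

variable {α : Type*} [LinearOrder α]

/-- `P = (p, q)` is a parking function `p` for the cars in `T`, with spaces `1, ..., #T`,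
together with its outcome `q`; both are extended by zero outside `T`. -/
structure IsParkingOn (T : Finset α) (P : (α → ℕ) × (α → ℕ)) : Prop where
  eq_zero : ∀ i, i ∉ T → P.1 i = 0 ∧ P.2 i = 0
  one_le : ∀ i ∈ T, 1 ≤ P.1 i
  le_outcome : ∀ i ∈ T, P.1 i ≤ P.2 i
  outcome_le : ∀ i ∈ T, P.2 i ≤ #T
  outcome_ne : ∀ i ∈ T, ∀ j ∈ T, j < i → P.2 j ≠ P.2 i
  occupied : ∀ i ∈ T, ∀ s, P.1 i ≤ s → s < P.2 i → ∃ j ∈ T, j < i ∧ P.2 j = s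

namespace IsParkingOn

variable {T : Finset α} {P : (α → ℕ) × (α → ℕ)}

lemma injOn (h : IsParkingOn T P) : Set.InjOn P.2 T := by
  intro i hi j hj hij
  rcases lt_trichotomy i j with hlt | rfl | hlt
  · exact absurd hij (h.outcome_ne j hj i hi hlt)
  · rfl
  · exact absurd hij.symm (h.outcome_ne i hi j hj hlt)

lemma image_eq (h : IsParkingOn T P) : T.image P.2 = Icc 1 #T := by
  apply eq_of_subset_of_card_le
  · intro s hs
    obtain ⟨i, hi, rfl⟩ := mem_image.1 hs
    exact mem_Icc.2 ⟨(h.one_le i hi).trans (h.le_outcome i hi), h.outcome_le i hi⟩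
  · rw [card_image_of_injOn h.injOn]
    simp

lemma exists_outcome_eq (h : IsParkingOn T P) {s : ℕ} (hs : 1 ≤ s) (hsT : s ≤ #T) :
    ∃ i ∈ T, P.2 i = s := by
  have : s ∈ T.image P.2 := by rw [h.image_eq]; exact mem_Icc.2 ⟨hs, hsT⟩
  simpa using this

lemma card_filter_outcome_le (h : IsParkingOn T P) {s : ℕ} (hs : s ≤ #T) :
    #(T.filter fun i => P.2 i ≤ s) = s := by
  rw [← card_image_of_injOn (h.injOn.mono (filter_subset _ _)), ← filter_image (p := fun x => x ≤ s),
    h.image_eq]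
  have : (Icc 1 #T).filter (fun x => x ≤ s) = Icc 1 s := by
    ext x; simp only [mem_filter, mem_Icc]; omega
  simp [this]

end IsParkingOn

/-- The parking function in which the cars in `Y` other than `m` park as in `P₁`, the cars in
`T` outside `Y` park as in `P₂` to the right of these, and `m` parks in between after `k` jumps. -/
def concat (T Y : Finset α) (m : α) (k : ℕ) (P₁ P₂ : (α → ℕ) × (α → ℕ)) :
    (α → ℕ) × (α → ℕ) :=
  (fun i => if i = m then #Y - k else if i ∈ Y then P₁.1 i else if i ∈ T then P₂.1 i + #Y else 0,
   fun i => if i = m then #Y else if i ∈ Y then P₁.2 i else if i ∈ T then P₂.2 i + #Y else 0)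

section Concat

variable {T Y : Finset α} {m : α} {k : ℕ} {P₁ P₂ : (α → ℕ) × (α → ℕ)}

lemma concat_fst_max : (concat T Y m k P₁ P₂).1 m = #Y - k := by simp [concat]

lemma concat_snd_max : (concat T Y m k P₁ P₂).2 m = #Y := by simp [concat]

lemma concat_fst_of_mem {i : α} (hi : i ∈ Y.erase m) : (concat T Y m k P₁ P₂).1 i = P₁.1 i := by
  rw [mem_erase] at hi; simp [concat, hi]

lemma concat_snd_of_mem {i : α} (hi : i ∈ Y.erase m) : (concat T Y m k P₁ P₂).2 i = P₁.2 i := by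
  rw [mem_erase] at hi; simp [concat, hi]

lemma concat_fst_of_mem_sdiff {i : α} (hm : m ∈ Y) (hi : i ∈ T \ Y) :
    (concat T Y m k P₁ P₂).1 i = P₂.1 i + #Y := by
  rw [mem_sdiff] at hi
  have : i ≠ m := fun h => hi.2 (h ▸ hm)
  simp [concat, hi, this]

lemma concat_snd_of_mem_sdiff {i : α} (hm : m ∈ Y) (hi : i ∈ T \ Y) :
    (concat T Y m k P₁ P₂).2 i = P₂.2 i + #Y := by
  rw [mem_sdiff] at hi
  have : i ≠ m := fun h => hi.2 (h ▸ hm)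
  simp [concat, hi, this]

lemma mem_cases (hm : m ∈ Y) {i : α} (hi : i ∈ T) : i = m ∨ i ∈ Y.erase m ∨ i ∈ T \ Y := by
  by_cases i = m <;> by_cases i ∈ Y <;> simp_all

lemma IsParkingOn.outcome_lt (h₁ : IsParkingOn (Y.erase m) P₁) (hm : m ∈ Y) {i : α}
    (hi : i ∈ Y.erase m) : P₁.2 i < #Y := by
  have := h₁.outcome_le i hi
  have := card_erase_add_one hm
  omega

lemma IsParkingOn.concat (h₁ : IsParkingOn (Y.erase m) P₁) (h₂ : IsParkingOn (T \ Y) P₂)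
    (hm : m ∈ Y) (hY : Y ⊆ T) (hmax : ∀ i ∈ T, i ≤ m) (hk : k < #Y) :
    IsParkingOn T (concat T Y m k P₁ P₂) := by
  have hcard : #(T \ Y) + #Y = #T := card_sdiff_add_card_eq_card hY
  have hcard' := card_erase_add_one hm
  have hYT : ∀ i ∈ Y.erase m, i ∈ T := fun i hi => hY (mem_of_mem_erase hi)
  have hTT : ∀ i ∈ T \ Y, i ∈ T := fun i hi => (mem_sdiff.1 hi).1
  have hpos₂ : ∀ i ∈ T \ Y, 1 ≤ P₂.2 i := fun i hi => (h₂.one_le i hi).trans (h₂.le_outcome i hi)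
  refine ⟨fun i hi => ?_, fun i hi => ?_, fun i hi => ?_, fun i hi => ?_, fun i hi j hj hij => ?_,
    fun i hi s hs hsi => ?_⟩
  · have hiY : i ∉ Y := fun h => hi (hY h)
    have him : i ≠ m := fun h => hiY (h ▸ hm)
    simp [_root_.concat, hi, hiY, him]
  · rcases mem_cases hm hi with rfl | hi | hi
    · rw [concat_fst_max]; omega
    · rw [concat_fst_of_mem hi]; exact h₁.one_le i hi
    · rw [concat_fst_of_mem_sdiff hm hi]; have := h₂.one_le i hi; omega
  · rcases mem_cases hm hi with rfl | hi | hi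
    · rw [concat_fst_max, concat_snd_max]; omega
    · rw [concat_fst_of_mem hi, concat_snd_of_mem hi]; exact h₁.le_outcome i hi
    · rw [concat_fst_of_mem_sdiff hm hi, concat_snd_of_mem_sdiff hm hi]
      have := h₂.le_outcome i hi; omega
  · rcases mem_cases hm hi with rfl | hi | hi
    · rw [concat_snd_max]; omega
    · rw [concat_snd_of_mem hi]; have := h₁.outcome_lt hm hi; omega
    · rw [concat_snd_of_mem_sdiff hm hi]; have := h₂.outcome_le i hi; omega
  · rcases mem_cases hm hi with rfl | hi' | hi' <;> rcases mem_cases hm hj with rfl | hj' | hj'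
    · exact absurd hij (lt_irrefl _)
    · rw [concat_snd_max, concat_snd_of_mem hj']
      exact (h₁.outcome_lt hm hj').ne
    · rw [concat_snd_max, concat_snd_of_mem_sdiff hm hj']
      have := hpos₂ j hj'; omega
    · exact absurd hij (hmax i hi).not_gt
    · rw [concat_snd_of_mem hi', concat_snd_of_mem hj']
      exact h₁.outcome_ne i hi' j hj' hij
    · rw [concat_snd_of_mem hi', concat_snd_of_mem_sdiff hm hj']
      have := h₁.outcome_lt hm hi'; omega
    · exact absurd hij (hmax i hi).not_gt
    · rw [concat_snd_of_mem hj', concat_snd_of_mem_sdiff hm hi']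
      have := h₁.outcome_lt hm hj'; omega
    · rw [concat_snd_of_mem_sdiff hm hi', concat_snd_of_mem_sdiff hm hj']
      have := h₂.outcome_ne i hi' j hj' hij; omega
  · rcases mem_cases hm hi with rfl | hi' | hi'
    · rw [concat_fst_max] at hs
      rw [concat_snd_max] at hsi
      obtain ⟨j, hj, rfl⟩ := h₁.exists_outcome_eq (s := s) (by omega) (by omega)
      exact ⟨j, hYT j hj, lt_of_le_of_ne (hmax j (hYT j hj)) (mem_erase.1 hj).1,
        concat_snd_of_mem hj⟩
    · rw [concat_fst_of_mem hi'] at hs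
      rw [concat_snd_of_mem hi'] at hsi
      obtain ⟨j, hj, hji, rfl⟩ := h₁.occupied i hi' s hs hsi
      exact ⟨j, hYT j hj, hji, concat_snd_of_mem hj⟩
    · rw [concat_fst_of_mem_sdiff hm hi'] at hs
      rw [concat_snd_of_mem_sdiff hm hi'] at hsi
      obtain ⟨j, hj, hji, hjs⟩ := h₂.occupied i hi' (s - #Y) (by omega) (by omega)
      refine ⟨j, hTT j hj, hji, ?_⟩
      rw [concat_snd_of_mem_sdiff hm hj]
      omega

lemma concat_snd_le_iff (h₁ : IsParkingOn (Y.erase m) P₁) (h₂ : IsParkingOn (T \ Y) P₂)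
    (hm : m ∈ Y) {i : α} (hi : i ∈ T) : (concat T Y m k P₁ P₂).2 i ≤ #Y ↔ i ∈ Y := by
  rcases mem_cases hm hi with rfl | hi | hi
  · simp [concat_snd_max, hm]
  · rw [concat_snd_of_mem hi]
    simp [(h₁.outcome_lt hm hi).le, mem_of_mem_erase hi]
  · rw [concat_snd_of_mem_sdiff hm hi]
    have := (h₂.one_le i hi).trans (h₂.le_outcome i hi)
    simp only [(mem_sdiff.1 hi).2, iff_false]
    omega

lemma concat_injective {Y' : Finset α} {k' : ℕ} {P₁' P₂' : (α → ℕ) × (α → ℕ)}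
    (h₁ : IsParkingOn (Y.erase m) P₁) (h₂ : IsParkingOn (T \ Y) P₂)
    (h₁' : IsParkingOn (Y'.erase m) P₁') (h₂' : IsParkingOn (T \ Y') P₂')
    (hm : m ∈ Y) (hm' : m ∈ Y') (hY : Y ⊆ T) (hY' : Y' ⊆ T) (hk : k < #Y) (hk' : k' < #Y')
    (h : concat T Y m k P₁ P₂ = concat T Y' m k' P₁' P₂') :
    Y = Y' ∧ k = k' ∧ P₁ = P₁' ∧ P₂ = P₂' := by
  have hcard : #Y = #Y' := by
    rw [← concat_snd_max (T := T) (Y := Y) (m := m) (k := k) (P₁ := P₁) (P₂ := P₂), h,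
      concat_snd_max]
  have hYY : Y = Y' := by
    ext i
    by_cases hi : i ∈ T
    · rw [← concat_snd_le_iff (k := k) h₁ h₂ hm hi, ← concat_snd_le_iff (k := k') h₁' h₂' hm' hi,
        h, hcard]
    · exact iff_of_false (fun h => hi (hY h)) (fun h => hi (hY' h))
  subst hYY
  have e₁ := fun i => congrFun (congrArg Prod.fst h) i
  have e₂ := fun i => congrFun (congrArg Prod.snd h) i
  have hkk : k = k' := by
    have := e₁ m
    rw [concat_fst_max, concat_fst_max] at this
    omega
  refine ⟨rfl, hkk, Prod.ext (funext fun i => ?_) (funext fun i => ?_),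
    Prod.ext (funext fun i => ?_) (funext fun i => ?_)⟩
  · by_cases hi : i ∈ Y.erase m
    · simpa only [concat_fst_of_mem hi] using e₁ i
    · rw [(h₁.eq_zero i hi).1, (h₁'.eq_zero i hi).1]
  · by_cases hi : i ∈ Y.erase m
    · simpa only [concat_snd_of_mem hi] using e₂ i
    · rw [(h₁.eq_zero i hi).2, (h₁'.eq_zero i hi).2]
  · by_cases hi : i ∈ T \ Y
    · simpa only [concat_fst_of_mem_sdiff hm hi, Nat.add_right_cancel_iff] using e₁ i
    · rw [(h₂.eq_zero i hi).1, (h₂'.eq_zero i hi).1]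
  · by_cases hi : i ∈ T \ Y
    · simpa only [concat_snd_of_mem_sdiff hm hi, Nat.add_right_cancel_iff] using e₂ i
    · rw [(h₂.eq_zero i hi).2, (h₂'.eq_zero i hi).2]

lemma exists_concat_eq {P : (α → ℕ) × (α → ℕ)} (hP : IsParkingOn T P) (hm : m ∈ T)
    (hmax : ∀ i ∈ T, i ≤ m) :
    ∃ Y k P₁ P₂, m ∈ Y ∧ Y ⊆ T ∧ k < #Y ∧ IsParkingOn (Y.erase m) P₁ ∧
      IsParkingOn (T \ Y) P₂ ∧ concat T Y m k P₁ P₂ = P := by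
  set Y := T.filter (fun i => P.2 i ≤ P.2 m) with hYdef
  have hY : Y ⊆ T := filter_subset _ _
  have hcard : #Y = P.2 m := hP.card_filter_outcome_le (hP.outcome_le m hm)
  have hmY : m ∈ Y := by simp [hYdef, hm]
  have hcard' := card_erase_add_one hmY
  have hcardT : #(T \ Y) + #Y = #T := card_sdiff_add_card_eq_card hY
  have hone := hP.one_le m hm
  have hle := hP.le_outcome m hm
  have hlt : ∀ i ∈ Y.erase m, P.2 i < P.2 m := by
    intro i hi
    rw [mem_erase, hYdef, mem_filter] at hi
    exact lt_of_le_of_ne hi.2.2 fun e => hi.1 (hP.injOn hi.2.1 hm e)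
  have hgt : ∀ i ∈ T \ Y, P.2 m < P.1 i := by
    intro i hi
    rw [mem_sdiff, hYdef, mem_filter, not_and, not_le] at hi
    by_contra hc
    obtain ⟨j, hj, hji, e⟩ := hP.occupied i hi.1 (P.2 m) (by omega) (hi.2 hi.1)
    rw [hP.injOn hj hm e] at hji
    exact absurd hji (hmax i hi.1).not_gt
  refine ⟨Y, P.2 m - P.1 m,
    (fun i => if i ∈ Y.erase m then P.1 i else 0, fun i => if i ∈ Y.erase m then P.2 i else 0),
    (fun i => if i ∈ T \ Y then P.1 i - #Y else 0, fun i => if i ∈ T \ Y then P.2 i - #Y else 0),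
    hmY, hY, by omega, ?_, ?_, ?_⟩
  · have hT : ∀ i ∈ Y.erase m, i ∈ T := fun i hi => hY (mem_of_mem_erase hi)
    refine ⟨fun i hi => ⟨if_neg hi, if_neg hi⟩, fun i hi => ?_, fun i hi => ?_, fun i hi => ?_,
      fun i hi j hj hij => ?_, fun i hi s hs hsi => ?_⟩
    · simpa only [if_pos hi] using hP.one_le i (hT i hi)
    · simpa only [if_pos hi] using hP.le_outcome i (hT i hi)
    · simp only [if_pos hi]
      have := hlt i hi
      omega
    · simpa only [if_pos hi, if_pos hj] using hP.outcome_ne i (hT i hi) j (hT j hj) hij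
    · simp only [if_pos hi] at hs hsi
      obtain ⟨j, hj, hji, rfl⟩ := hP.occupied i (hT i hi) s hs hsi
      have := hlt i hi
      have hjY : j ∈ Y.erase m := by
        rw [mem_erase, hYdef, mem_filter]
        refine ⟨?_, hj, by omega⟩
        rintro rfl
        omega
      exact ⟨j, hjY, hji, if_pos hjY⟩
  · have hT : ∀ i ∈ T \ Y, i ∈ T := fun i hi => (mem_sdiff.1 hi).1
    refine ⟨fun i hi => ⟨if_neg hi, if_neg hi⟩, fun i hi => ?_, fun i hi => ?_, fun i hi => ?_,
      fun i hi j hj hij => ?_, fun i hi s hs hsi => ?_⟩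
    · simp only [if_pos hi]
      have := hgt i hi
      omega
    · simp only [if_pos hi]
      have := hP.le_outcome i (hT i hi)
      omega
    · simp only [if_pos hi]
      have := hP.outcome_le i (hT i hi)
      omega
    · simp only [if_pos hi, if_pos hj]
      have := hgt i hi
      have := hgt j hj
      have := hP.le_outcome i (hT i hi)
      have := hP.le_outcome j (hT j hj)
      have := hP.outcome_ne i (hT i hi) j (hT j hj) hij
      omega
    · simp only [if_pos hi] at hs hsi
      have := hgt i hi
      obtain ⟨j, hj, hji, e⟩ := hP.occupied i (hT i hi) (s + #Y) (by omega) (by omega)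
      have hjY : j ∈ T \ Y := by
        rw [mem_sdiff, hYdef, mem_filter]
        exact ⟨hj, fun h => by omega⟩
      refine ⟨j, hjY, hji, ?_⟩
      simp only [if_pos hjY]
      omega
  · refine Prod.ext (funext fun i => ?_) (funext fun i => ?_) <;> by_cases hi : i ∈ T
    · rcases mem_cases hmY hi with rfl | hi | hi
      · rw [concat_fst_max]
        omega
      · rw [concat_fst_of_mem hi]
        exact if_pos hi
      · rw [concat_fst_of_mem_sdiff hmY hi]
        simp only [if_pos hi]
        have := hgt i hi
        omega
    · have hiY : i ∉ Y := fun h => hi (hY h)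
      have him : i ≠ m := fun h => hi (h ▸ hm)
      simp [concat, hi, hiY, him, (hP.eq_zero i hi).1]
    · rcases mem_cases hmY hi with rfl | hi' | hi'
      · rw [concat_snd_max, hcard]
      · rw [concat_snd_of_mem hi']
        exact if_pos hi'
      · rw [concat_snd_of_mem_sdiff hmY hi']
        simp only [if_pos hi']
        have := hgt i hi'
        have := hP.le_outcome i hi
        omega
    · have hiY : i ∉ Y := fun h => hi (hY h)
      have him : i ≠ m := fun h => hi (h ▸ hm)
      simp [concat, hi, hiY, him, (hP.eq_zero i hi).2]

end Concat

end Parking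

section Matching

variable {α : Type*} [LinearOrder α]

/-- The number of descendants `x < v` of `v` in the forest with parent function `f`. -/
noncomputable def invAt (f : α → Option α) (v : α) : ℕ := Set.ncard {x | x < v ∧ Reach f x v}

/-- There is a bijection from the vertices in `S` to the cars in `T` that takes inversions to
jumps and roots to right-to-left maxima. -/
def Matched (S T : Finset α) (f : α → Option α) (P : (α → ℕ) × (α → ℕ)) : Prop :=
  ∃ θ : α → α, Set.BijOn θ S T ∧ (∀ v ∈ S, invAt f v = P.2 (θ v) - P.1 (θ v)) ∧
    ∀ v ∈ S, f v = none → ∀ c ∈ T, P.2 (θ v) < P.2 c → c < θ v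

lemma Matched.graft_concat {S T X Y : Finset α} {r m : α} {k : ℕ} {f₁ f₂ : α → Option α}
    {P₁ P₂ : (α → ℕ) × (α → ℕ)} (h₁ : IsForestOn (X.erase r) f₁) (h₂ : IsForestOn (S \ X) f₂)
    (hr : r ∈ X) (hX : X ⊆ S) (h₁' : IsParkingOn (Y.erase m) P₁) (h₂' : IsParkingOn (T \ Y) P₂)
    (hm : m ∈ Y) (hY : Y ⊆ T) (hmax : ∀ i ∈ T, i ≤ m) (hk : k < #Y)
    (hkr : k = #(X.filter (· < r)))
    (hM₁ : Matched (X.erase r) (Y.erase m) f₁ P₁) (hM₂ : Matched (S \ X) (T \ Y) f₂ P₂) :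
    Matched S T (graft X r f₁ f₂) (concat T Y m k P₁ P₂) := by
  obtain ⟨θ₁, hθ₁, hinv₁, -⟩ := hM₁
  obtain ⟨θ₂, hθ₂, hinv₂, hroot₂⟩ := hM₂
  set θ : α → α := fun v => if v = r then m else if v ∈ X then θ₁ v else θ₂ v with hθ
  have hθr : θ r = m := if_pos rfl
  have hθX : ∀ v ∈ X.erase r, θ v = θ₁ v := fun v hv => by
    rw [mem_erase] at hv; simp [hθ, hv]
  have hθS : ∀ v ∈ S \ X, θ v = θ₂ v := fun v hv => by
    rw [mem_sdiff] at hv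
    have : v ≠ r := fun h => hv.2 (h ▸ hr)
    simp [hθ, hv, this]
  have hmem₁ : ∀ v ∈ X.erase r, θ v ∈ Y.erase m := fun v hv => by
    rw [hθX v hv]; exact hθ₁.mapsTo hv
  have hmem₂ : ∀ v ∈ S \ X, θ v ∈ T \ Y := fun v hv => by
    rw [hθS v hv]; exact hθ₂.mapsTo hv
  refine ⟨θ, ⟨fun v hv => ?_, fun v hv w hw hvw => ?_, fun c hc => ?_⟩, fun v hv => ?_,
    fun v hv hroot c hc hlt => ?_⟩
  · rcases mem_cases hr hv with rfl | hv | hv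
    · rw [hθr]; exact hY hm
    · exact hY (mem_of_mem_erase (hmem₁ v hv))
    · exact (mem_sdiff.1 (hmem₂ v hv)).1
  · rcases mem_cases hr hv with rfl | hv' | hv' <;> rcases mem_cases hr hw with rfl | hw' | hw'
    · rfl
    · have := hmem₁ w hw'
      rw [← hvw, hθr] at this
      simp at this
    · have := hmem₂ w hw'
      rw [← hvw, hθr] at this
      simp [hm] at this
    · have := hmem₁ v hv'
      rw [hvw, hθr] at this
      simp at this
    · rw [hθX v hv', hθX w hw'] at hvw
      exact hθ₁.injOn hv' hw' hvw
    · have h := hmem₁ v hv'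
      have h' := hmem₂ w hw'
      rw [hvw] at h
      exact absurd (mem_of_mem_erase h) (mem_sdiff.1 h').2
    · have := hmem₂ v hv'
      rw [hvw, hθr] at this
      simp [hm] at this
    · have h := hmem₂ v hv'
      have h' := hmem₁ w hw'
      rw [hvw] at h
      exact absurd (mem_of_mem_erase h') (mem_sdiff.1 h).2
    · rw [hθS v hv', hθS w hw'] at hvw
      exact hθ₂.injOn hv' hw' hvw
  · rcases mem_cases hm hc with rfl | hc | hc
    · exact ⟨r, hX hr, hθr⟩
    · obtain ⟨v, hv, rfl⟩ := hθ₁.surjOn hc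
      exact ⟨v, hX (mem_of_mem_erase hv), hθX v hv⟩
    · obtain ⟨v, hv, rfl⟩ := hθ₂.surjOn hc
      exact ⟨v, (mem_sdiff.1 hv).1, hθS v hv⟩
  · rcases mem_cases hr hv with rfl | hv | hv
    · rw [hθr, concat_fst_max, concat_snd_max, invAt]
      simp only [reach_graft_root h₁ h₂ hr]
      have : {x | x < v ∧ x ∈ X} = ↑(X.filter (· < v)) := by
        ext x; simp [and_comm]
      rw [this, Set.ncard_coe_finset, ← hkr]
      omega
    · have hv' := mem_erase.1 hv
      have := hinv₁ v hv
      rw [concat_fst_of_mem (hmem₁ v hv), concat_snd_of_mem (hmem₁ v hv), hθX v hv, ← this,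
        invAt, invAt]
      simp only [reach_graft_of_mem h₁ h₂ hr hv'.2 hv'.1]
    · have hv' := mem_sdiff.1 hv
      have := hinv₂ v hv
      rw [concat_fst_of_mem_sdiff hm (hmem₂ v hv), concat_snd_of_mem_sdiff hm (hmem₂ v hv),
        Nat.add_sub_add_right, hθS v hv, ← this, invAt, invAt]
      simp only [reach_graft_of_notMem h₁ h₂ hr hv'.2]
  · rcases mem_cases hr hv with rfl | hv | hv
    · rw [hθr] at hlt ⊢
      exact lt_of_le_of_ne (hmax c hc) fun h => by simp [h] at hlt
    · rw [graft_of_mem (mem_erase.1 hv).2 (mem_erase.1 hv).1] at hroot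
      simp at hroot
    · rw [graft_of_notMem hr (mem_sdiff.1 hv).2] at hroot
      rw [concat_snd_of_mem_sdiff hm (hmem₂ v hv)] at hlt
      have hc' : c ∈ T \ Y := by
        refine mem_sdiff.2 ⟨hc, fun h => ?_⟩
        have := (concat_snd_le_iff (k := k) h₁' h₂' hm hc).2 h
        omega
      rw [concat_snd_of_mem_sdiff hm hc', hθS v hv] at hlt
      rw [hθS v hv]
      exact hroot₂ v hv hroot c hc' (by omega)

lemma bijOn_card_filter_lt (X : Finset α) :
    Set.BijOn (fun r => #(X.filter (· < r))) X (range #X) := by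
  have hmaps : Set.MapsTo (fun r => #(X.filter (· < r))) X (range #X) := fun r hr => by
    rw [mem_coe, mem_range]
    exact card_lt_card (filter_ssubset.2 ⟨r, hr, lt_irrefl r⟩)
  have hmono : StrictMonoOn (fun r => #(X.filter (· < r))) (X : Set α) := by
    intro r hr s _ hrs
    refine card_lt_card ⟨fun x hx => ?_, fun h => ?_⟩
    · rw [mem_filter] at hx ⊢
      exact ⟨hx.1, hx.2.trans hrs⟩
    · exact lt_irrefl r (mem_filter.1 (h (mem_filter.2 ⟨hr, hrs⟩))).2
  exact ⟨hmaps, hmono.injOn, surjOn_of_injOn_of_card_le _ hmaps hmono.injOn (by simp)⟩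

/-- Rooted trees inside `S` through `m` and their roots. -/
abbrev TreeIndex (S : Finset α) (m : α) : Type _ :=
  {x : Finset α × α // m ∈ x.1 ∧ x.1 ⊆ S ∧ x.2 ∈ x.1}

/-- Sets of cars in `T` containing `m`, with a number of jumps for `m`. -/
abbrev BlockIndex (T : Finset α) (m : α) : Type _ :=
  {y : Finset α × ℕ // m ∈ y.1 ∧ y.1 ⊆ T ∧ y.2 < #y.1}

lemma exists_index_equiv {S T : Finset α} {g : α → α} {m : α} (hg : Set.BijOn g S T)
    (hm : m ∈ S) :
    ∃ ψ : TreeIndex S m ≃ BlockIndex T (g m), ∀ x,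
      #(ψ x).1.1 = #x.1.1 ∧ (ψ x).1.2 = #(x.1.1.filter (· < x.1.2)) := by
  have hcard : ∀ X ⊆ S, #(X.image g) = #X := fun X hX =>
    card_image_of_injOn (hg.injOn.mono (by exact_mod_cast hX))
  let ψ : TreeIndex S m → BlockIndex T (g m) := fun x =>
    ⟨(x.1.1.image g, #(x.1.1.filter (· < x.1.2))), mem_image_of_mem g x.2.1,
      image_subset_iff.2 fun i hi => hg.mapsTo (x.2.2.1 hi), by
        simp only [hcard _ x.2.2.1]
        exact mem_range.1 ((bijOn_card_filter_lt x.1.1).mapsTo x.2.2.2)⟩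
  have hψ : Function.Bijective ψ := by
    constructor
    · rintro ⟨⟨X, r⟩, hmX, hX, hr⟩ ⟨⟨X', r'⟩, hmX', hX', hr'⟩ h
      simp only [ψ, Subtype.mk.injEq, Prod.mk.injEq] at h
      obtain ⟨h, hrk⟩ := h
      have hXX : X = X' := by
        have h' : Set.image g X = Set.image g X' := by
          exact_mod_cast congrArg (fun Z : Finset α => (Z : Set α)) h
        exact_mod_cast (hg.injOn.image_eq_image_iff (by exact_mod_cast hX)
          (by exact_mod_cast hX')).1 h'
      subst hXX
      obtain rfl : r = r' := (bijOn_card_filter_lt X).injOn hr hr' hrk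
      rfl
    · rintro ⟨⟨Y, k⟩, hmY, hY, hk⟩
      have himg : (S.filter (g · ∈ Y)).image g = Y := by
        ext c
        simp only [mem_image, mem_filter]
        constructor
        · rintro ⟨v, ⟨-, hv⟩, rfl⟩
          exact hv
        · intro hc
          obtain ⟨v, hv, rfl⟩ := hg.surjOn (hY hc)
          exact ⟨v, ⟨hv, hc⟩, rfl⟩
      have hc : #(S.filter (g · ∈ Y)) = #Y := by rw [← hcard _ (filter_subset _ _), himg]
      obtain ⟨r, hr, hrk⟩ := (bijOn_card_filter_lt (S.filter (g · ∈ Y))).surjOn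
        (mem_coe.2 (mem_range.2 (hc ▸ hk)))
      refine ⟨⟨(S.filter (g · ∈ Y), r), mem_filter.2 ⟨hm, hmY⟩, filter_subset _ _, hr⟩, ?_⟩
      simp only [ψ, Subtype.mk.injEq, Prod.mk.injEq]
      exact ⟨himg, hrk⟩
  exact ⟨Equiv.ofBijective ψ hψ, fun x => ⟨hcard _ x.2.2.1, rfl⟩⟩

/-- Rooted forests on the vertex set `S`. -/
abbrev ForestOn (S : Finset α) : Type _ := {f : α → Option α // IsForestOn S f}

/-- Parking functions for the cars in `T`, with their outcomes. -/
abbrev ParkingOn (T : Finset α) : Type _ := {P : (α → ℕ) × (α → ℕ) // IsParkingOn T P}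

/-- A forest, decomposed along the tree that contains `m`. -/
noncomputable def graftEquiv (S : Finset α) (m : α) (hm : m ∈ S) :
    (Σ x : TreeIndex S m, ForestOn (x.1.1.erase x.1.2) × ForestOn (S \ x.1.1)) ≃ ForestOn S :=
  Equiv.ofBijective
    (fun z => ⟨graft z.1.1.1 z.1.1.2 z.2.1.1 z.2.2.1,
      z.2.1.2.graft z.2.2.2 z.1.2.2.2 z.1.2.2.1⟩) <| by
    constructor
    · rintro ⟨⟨⟨X, r⟩, hmX, hX, hr⟩, ⟨f₁, h₁⟩, ⟨f₂, h₂⟩⟩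
        ⟨⟨⟨X', r'⟩, hmX', hX', hr'⟩, ⟨f₁', h₁'⟩, ⟨f₂', h₂'⟩⟩ h
      obtain ⟨rfl, rfl, rfl, rfl⟩ :=
        graft_injective h₁ h₂ h₁' h₂' hr hr' hmX hmX' (congrArg Subtype.val h)
      rfl
    · rintro ⟨f, hf⟩
      obtain ⟨X, r, f₁, f₂, hmX, hX, hr, h₁, h₂, h⟩ := exists_graft_eq hf hm
      exact ⟨⟨⟨(X, r), hmX, hX, hr⟩, ⟨f₁, h₁⟩, ⟨f₂, h₂⟩⟩, Subtype.ext h⟩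

/-- A parking function, decomposed along the space of its last car `m`. -/
noncomputable def concatEquiv (T : Finset α) (m : α) (hm : m ∈ T) (hmax : ∀ i ∈ T, i ≤ m) :
    (Σ y : BlockIndex T m, ParkingOn (y.1.1.erase m) × ParkingOn (T \ y.1.1)) ≃ ParkingOn T :=
  Equiv.ofBijective
    (fun z => ⟨concat T z.1.1.1 m z.1.1.2 z.2.1.1 z.2.2.1,
      z.2.1.2.concat z.2.2.2 z.1.2.1 z.1.2.2.1 hmax z.1.2.2.2⟩) <| by
    constructor
    · rintro ⟨⟨⟨Y, k⟩, hmY, hY, hk⟩, ⟨P₁, h₁⟩, ⟨P₂, h₂⟩⟩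
        ⟨⟨⟨Y', k'⟩, hmY', hY', hk'⟩, ⟨P₁', h₁'⟩, ⟨P₂', h₂'⟩⟩ h
      obtain ⟨rfl, rfl, rfl, rfl⟩ :=
        concat_injective h₁ h₂ h₁' h₂' hmY hmY' hY hY' hk hk' (congrArg Subtype.val h)
      rfl
    · rintro ⟨P, hP⟩
      obtain ⟨Y, k, P₁, P₂, hmY, hY, hk, h₁, h₂, h⟩ := exists_concat_eq hP hm hmax
      exact ⟨⟨⟨(Y, k), hmY, hY, hk⟩, ⟨P₁, h₁⟩, ⟨P₂, h₂⟩⟩, Subtype.ext h⟩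

lemma isParkingOn_empty_iff {P : (α → ℕ) × (α → ℕ)} : IsParkingOn ∅ P ↔ P = 0 := by
  constructor
  · exact fun h => Prod.ext (funext fun i => (h.eq_zero i (notMem_empty i)).1)
      (funext fun i => (h.eq_zero i (notMem_empty i)).2)
  · rintro rfl
    constructor <;> simp

lemma exists_matching_equiv (S T : Finset α) (hST : #S = #T) :
    ∃ φ : ForestOn S ≃ ParkingOn T, ∀ F, Matched S T F.1 (φ F).1 := by
  induction hn : #S using Nat.strong_induction_on generalizing S T with
  | _ n ih =>
  rcases T.eq_empty_or_nonempty with rfl | hT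
  · obtain rfl : S = ∅ := by simpa using hST
    let φ : ForestOn (∅ : Finset α) → ParkingOn (∅ : Finset α) :=
      fun _ => ⟨0, isParkingOn_empty_iff.2 rfl⟩
    have hφ : Function.Bijective φ :=
      ⟨fun F G _ => Subtype.ext
          ((isForestOn_empty_iff.1 F.2).trans (isForestOn_empty_iff.1 G.2).symm),
        fun P => ⟨⟨_, isForestOn_empty_iff.2 rfl⟩, Subtype.ext (isParkingOn_empty_iff.1 P.2).symm⟩⟩
    exact ⟨Equiv.ofBijective φ hφ, fun F => ⟨id, by simp, by simp, by simp⟩⟩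
  have : Nonempty α := ⟨hT.choose⟩
  obtain ⟨g, hg⟩ := S.finite_toSet.exists_bijOn_of_encard_eq (t := (T : Set α)) (by simp [hST])
  obtain ⟨m, hm, hgm⟩ := hg.surjOn (T.max'_mem hT)
  have hmax : ∀ i ∈ T, i ≤ g m := fun i hi => hgm ▸ T.le_max' i hi
  obtain ⟨ψ, hψ⟩ := exists_index_equiv hg hm
  have hlt₁ : ∀ x : TreeIndex S m, #(x.1.1.erase x.1.2) < n := fun x => by
    have := card_erase_add_one x.2.2.2
    have := card_le_card x.2.2.1
    omega
  have hlt₂ : ∀ x : TreeIndex S m, #(S \ x.1.1) < n := fun x => by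
    have := card_sdiff_add_card_eq_card x.2.2.1
    have := card_pos.2 ⟨m, x.2.1⟩
    omega
  have hcard₁ : ∀ x : TreeIndex S m, #(x.1.1.erase x.1.2) =
      #((ψ x).1.1.erase (g m)) := fun x => by
    rw [card_erase_of_mem x.2.2.2, card_erase_of_mem (ψ x).2.1, (hψ x).1]
  have hcard₂ : ∀ x : TreeIndex S m, #(S \ x.1.1) = #(T \ (ψ x).1.1) := fun x => by
    rw [card_sdiff_of_subset x.2.2.1, card_sdiff_of_subset (ψ x).2.2.1, (hψ x).1, hST]
  choose φ₁ hφ₁ using fun x => ih _ (hlt₁ x) _ _ (hcard₁ x) rfl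
  choose φ₂ hφ₂ using fun x => ih _ (hlt₂ x) _ _ (hcard₂ x) rfl
  let Φ := Equiv.sigmaCongr (β₂ := fun y : BlockIndex T (g m) =>
    ParkingOn (y.1.1.erase (g m)) × ParkingOn (T \ y.1.1)) ψ
    fun x => Equiv.prodCongr (φ₁ x) (φ₂ x)
  refine ⟨(graftEquiv S m hm).symm.trans (Φ.trans (concatEquiv T (g m) (hg.mapsTo hm) hmax)),
    fun F => ?_⟩
  obtain ⟨⟨x, F₁, F₂⟩, rfl⟩ := (graftEquiv S m hm).surjective F
  simp only [Equiv.trans_apply, Equiv.symm_apply_apply]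
  exact Matched.graft_concat F₁.2 F₂.2 x.2.2.2 x.2.2.1 (φ₁ x F₁).2 (φ₂ x F₂).2 (ψ x).2.1
    (ψ x).2.2.1 hmax (ψ x).2.2.2 (hψ x).2 (hφ₁ x F₁) (hφ₂ x F₂)

end Matching

section Transfer

variable {n : ℕ}

lemma isForest_iff {f : Fin n → Option (Fin n)} : IsForest f ↔ IsForestOn univ f :=
  ⟨fun h => ⟨by simp, by simp, exists_root_of_acyclic h⟩,
    fun h => not_transGen_self_of_exists_root h.exists_root⟩

lemma PA_spec (p : Fin n → ℕ) (i : Fin n) :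
    p i ≤ PA p i ∧ ∀ j : Fin n, j < i → PA p j ≠ PA p i := by
  have hne : {s : ℕ | p i ≤ s ∧ ∀ j : Fin n, j < i → PA p j ≠ s}.Nonempty := by
    refine ⟨p i + ∑ j, (PA p j + 1), by simp, fun j _ => ?_⟩
    have := single_le_sum (f := fun j => PA p j + 1) (fun _ _ => Nat.zero_le _) (mem_univ j)
    omega
  have := Nat.sInf_mem hne
  rw [← PA] at this
  exact this

lemma exists_PA_eq {p : Fin n → ℕ} {i : Fin n} {s : ℕ} (hs : p i ≤ s) (hsi : s < PA p i) :
    ∃ j : Fin n, j < i ∧ PA p j = s := by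
  rw [PA] at hsi
  have := Nat.notMem_of_lt_sInf hsi
  simpa [hs] using this

lemma isParkingFunction_iff {p : Fin n → ℕ} :
    IsParkingFunction p ↔ IsParkingOn univ (p, PA p) := by
  constructor
  · intro h
    exact ⟨by simp, fun i _ => (h.1 i).1, fun i _ => (PA_spec p i).1,
      fun i _ => by simpa using h.2 i,
      fun i _ j _ hij => (PA_spec p i).2 j hij,
      fun i _ s hs hsi => by simpa using exists_PA_eq hs hsi⟩
  · intro h
    have hle : ∀ i, PA p i ≤ n := fun i => by simpa using h.outcome_le i (mem_univ i)
    exact ⟨fun i => ⟨h.one_le i (mem_univ i), (PA_spec p i).1.trans (hle i)⟩, hle⟩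

lemma IsParkingOn.snd_eq_PA {P : (Fin n → ℕ) × (Fin n → ℕ)} (h : IsParkingOn univ P) :
    P.2 = PA P.1 := by
  funext i
  induction i using WellFoundedLT.induction with
  | _ i ih =>
  rcases lt_trichotomy (P.2 i) (PA P.1 i) with hlt | heq | hlt
  · obtain ⟨j, hj, e⟩ := exists_PA_eq (h.le_outcome i (mem_univ i)) hlt
    exact absurd ((ih j hj).trans e) (h.outcome_ne i (mem_univ i) j (mem_univ j) hj)
  · exact heq
  · obtain ⟨j, -, hj, e⟩ := h.occupied i (mem_univ i) _ (PA_spec P.1 i).1 hlt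
    exact absurd ((ih j hj).symm.trans e) ((PA_spec P.1 i).2 j hj)

/-- Parking functions of length `n` as parking functions for all cars in `Fin n`. -/
noncomputable def parkingOnEquiv (n : ℕ) :
    ParkingOn (univ : Finset (Fin n)) ≃ ParkingFunction n where
  toFun P := ⟨P.1.1, isParkingFunction_iff.2 (by rw [← P.2.snd_eq_PA]; exact P.2)⟩
  invFun p := ⟨(p.1, PA p.1), isParkingFunction_iff.1 p.2⟩
  left_inv P := Subtype.ext (Prod.ext rfl P.2.snd_eq_PA.symm)
  right_inv _ := rfl

/-- Forests on `n` vertices as forests on the vertex set `univ`. -/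
def forestOnEquiv (n : ℕ) : Forest n ≃ ForestOn (univ : Finset (Fin n)) :=
  Equiv.subtypeEquivRight fun _ => isForest_iff

end Transfer

/-- For every `n ≥ 1` there exist a bijection `φ : F_n → PF_n` and,
for each forest `F`, a bijection `θ_F` from the vertices of `F` to the cars of `φ F`,
such that (1) `inv(F:v) = jump(φF : θ_F v)` for every vertex `v`, and (2) if `v` is a
root of a tree of `F`, then `θ_F v` is a right-to-left maximum in `PA(φF)⁻¹`: every car
parked in a space strictly to the right of the space of car `θ_F v` has a smaller car
number. -/
theorem exists_bijection_with_theta (n : ℕ) (hn : 1 ≤ n) :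
    ∃ φ : Forest n ≃ ParkingFunction n,
      ∀ F : Forest n, ∃ θ : Fin n ≃ Fin n,
        (∀ v : Fin n, forestInvAt F v = jumpAt (φ F).1 (θ v)) ∧
        (∀ v : Fin n, F.1 v = none →
          ∀ c : Fin n, PA (φ F).1 (θ v) < PA (φ F).1 c → c < θ v) := by
  obtain ⟨φ, hφ⟩ := exists_matching_equiv (univ : Finset (Fin n)) univ rfl
  refine ⟨(forestOnEquiv n).trans (φ.trans (parkingOnEquiv n)), fun F => ?_⟩
  obtain ⟨θ, hθ, hinv, hroot⟩ := hφ (forestOnEquiv n F)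
  rw [(φ (forestOnEquiv n F)).2.snd_eq_PA] at hinv hroot
  rw [coe_univ, Set.bijOn_univ] at hθ
  exact ⟨Equiv.ofBijective θ hθ, fun v => hinv v (mem_univ v),
    fun v hv c => hroot v (mem_univ v) hv c (mem_univ c)⟩
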